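/- Let 𝒞 be a commutative unital C*-algebra, δ : 𝒞 → 𝒞 a unital *-algebra endomorphism, and A : 𝒞 → 𝒞 a transfer operator for the C*-dynamical system (𝒞, δ), i.e. a positive linear operator satisfying A((δf)·g) = f·(Ag) for all f, g ∈ 𝒞. Then for every δ-invariant state μ on 𝒞, the t-entropy of μ satisfies τ(μ) = inf_{n ∈ ℕ, D} (1/n) Σ_{g ∈ D} μ(g) · ln( μ(Aⁿg) / μ(g) ), where the infimum is taken over all positive integers n and all partitions of unity D in 𝒞. -/

import Mathlib

open scoped BigOperators ComplexOrder

/-- The summand `μ(g) · ln(m(Aⁿg)/μ(g))` (values of states at nonnegative elements are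
nonnegative reals), with the conventions: it is `0` whenever `μ(g) = 0` (regardless of
`m(Aⁿg)`), and it is `−∞` when `μ(g) > 0` but `m(Aⁿg) = 0`. -/
noncomputable def tSummandC (a b : ℂ) : EReal :=
  if a = 0 then 0 else if b = 0 then ⊥ else ((a.re * Real.log (b.re / a.re) : ℝ) : EReal)

section

variable (𝒞 : Type*) [NormedCommRing 𝒞] [StarRing 𝒞] [CStarRing 𝒞] [NormedAlgebra ℂ 𝒞]
  [StarModule ℂ 𝒞] [PartialOrder 𝒞] [StarOrderedRing 𝒞] [CompleteSpace 𝒞]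

variable {𝒞}

/-- A partition of unity in the algebra `𝒞`: a finite set of nonnegative elements
summing to `1`. -/
def IsPartitionOfUnityAlg (D : Finset 𝒞) : Prop :=
  (∀ g ∈ D, 0 ≤ g) ∧ ∑ g ∈ D, g = 1

/-- A state on `𝒞`: a positive normalized linear functional. -/
def IsState (μ : 𝒞 →ₗ[ℂ] ℂ) : Prop :=
  (∀ f : 𝒞, 0 ≤ f → 0 ≤ μ f) ∧ μ 1 = 1

/-- `τ_n(μ) = inf_D sup_m Σ_{g ∈ D} μ(g) ln(m(Aⁿg)/μ(g))`. -/
noncomputable def tauNAlg (A : 𝒞 →ₗ[ℂ] 𝒞) (μ : 𝒞 →ₗ[ℂ] ℂ) (n : ℕ) : EReal :=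
  ⨅ (D : Finset 𝒞) (_ : IsPartitionOfUnityAlg D),
    ⨆ (m : 𝒞 →ₗ[ℂ] ℂ) (_ : IsState m),
      ∑ g ∈ D, tSummandC (μ g) (m ((A ^ n) g))

/-- The `t`-entropy `τ(μ) = inf_{n ≥ 1} τ_n(μ)/n`. -/
noncomputable def tEntropyAlg (A : 𝒞 →ₗ[ℂ] 𝒞) (μ : 𝒞 →ₗ[ℂ] ℂ) : EReal :=
  ⨅ n : ℕ+, ((((n : ℕ) : ℝ))⁻¹ : EReal) * tauNAlg A μ (n : ℕ)

/-- A star-algebra equivalence with continuous functions on the character space, in the unbundled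
setting of this file. -/
theorem exists_gelfand (𝒟 : Type*) [NormedCommRing 𝒟] [StarRing 𝒟] [CStarRing 𝒟]
    [NormedAlgebra ℂ 𝒟] [StarModule ℂ 𝒟] [CompleteSpace 𝒟] :
    Nonempty (𝒟 ≃⋆ₐ[ℂ] C(WeakDual.characterSpace ℂ 𝒟, ℂ)) := by
  let _ : CommCStarAlgebra 𝒟 := {}
  exact ⟨gelfandStarTransform 𝒟⟩

/-- The Gelfand isomorphism. -/
noncomputable def gelf : 𝒞 ≃⋆ₐ[ℂ] C(WeakDual.characterSpace ℂ 𝒞, ℂ) :=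
  (exists_gelfand 𝒞).some

theorem gelf_nonneg_of_nonneg {f : 𝒞} (hf : 0 ≤ f) (x : WeakDual.characterSpace ℂ 𝒞) :
    0 ≤ gelf f x := by
  rw [StarOrderedRing.nonneg_iff] at hf
  induction hf using AddSubmonoid.closure_induction with
  | mem y hy =>
    obtain ⟨s, rfl⟩ := hy
    simp only [map_mul, map_star, ContinuousMap.mul_apply, ContinuousMap.star_apply]
    exact star_mul_self_nonneg _
  | zero => simp
  | add a b _ _ ha hb => simpa using add_nonneg ha hb

theorem nonneg_of_gelf_nonneg {f : 𝒞} (hf : ∀ x, 0 ≤ gelf f x) : 0 ≤ f := by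
  let s : C(WeakDual.characterSpace ℂ 𝒞, ℂ) :=
    ⟨fun x => ((Real.sqrt (gelf f x).re : ℝ) : ℂ), by fun_prop⟩
  have h : f = star (gelf.symm s) * gelf.symm s := by
    rw [← map_star, ← map_mul]
    apply EquivLike.injective gelf
    rw [StarAlgEquiv.apply_symm_apply]
    ext x
    have h1 := (Complex.nonneg_iff.1 (hf x))
    simp only [s, ContinuousMap.mul_apply, ContinuousMap.star_apply, ContinuousMap.coe_mk]
    rw [Complex.star_def, Complex.conj_ofReal, ← Complex.ofReal_mul, Real.mul_self_sqrt h1.1]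
    apply Complex.ext <;> simp [← h1.2]
  rw [h]
  exact star_mul_self_nonneg _

theorem le_of_gelf_le {f g : 𝒞} (h : ∀ x, gelf f x ≤ gelf g x) : f ≤ g := by
  rw [← sub_nonneg]
  apply nonneg_of_gelf_nonneg
  intro x
  simpa using h x

theorem alg_mul_nonneg {f g : 𝒞} (hf : 0 ≤ f) (hg : 0 ≤ g) : 0 ≤ f * g := by
  apply nonneg_of_gelf_nonneg
  intro x
  simpa using mul_nonneg (gelf_nonneg_of_nonneg hf x) (gelf_nonneg_of_nonneg hg x)

theorem exists_fine (D : Finset 𝒞) (f : 𝒞 → 𝒞) (hf : ∀ g ∈ D, 0 ≤ f g) (ε : ℝ) (hε : 0 < ε) :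
    ∃ (t : Finset (WeakDual.characterSpace ℂ 𝒞)) (e : WeakDual.characterSpace ℂ 𝒞 → 𝒞)
      (C : 𝒞 → WeakDual.characterSpace ℂ 𝒞 → ℝ),
      (∀ i, 0 ≤ e i) ∧ ∑ i ∈ t, e i = 1 ∧ (∀ g ∈ D, ∀ i, 0 ≤ C g i) ∧
      (∀ g ∈ D, ∀ i, e i * f g ≤ (C g i : ℂ) • e i) ∧
      ∀ g ∈ D, ∑ i ∈ t, (C g i : ℂ) • e i ≤ f g + ((2 * ε : ℝ) : ℂ) • (1 : 𝒞) := by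
  classical
  let Φ : WeakDual.characterSpace ℂ 𝒞 → (D → ℝ) := fun x g => (gelf (f g) x).re
  have hΦ : Continuous Φ := by
    refine continuous_pi fun g => ?_
    exact Complex.continuous_re.comp (gelf (f g)).continuous
  obtain ⟨t, ht⟩ := CompactSpace.elim_nhds_subcover
    (fun x => Φ ⁻¹' (Metric.ball (Φ x) ε))
    (fun x => hΦ.continuousAt.preimage_mem_nhds (Metric.ball_mem_nhds _ hε))
  let w : WeakDual.characterSpace ℂ 𝒞 → WeakDual.characterSpace ℂ 𝒞 → ℝ :=
    fun i y => max 0 (ε - dist (Φ y) (Φ i))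
  have hw0 : ∀ i y, 0 ≤ w i y := fun i y => le_max_left _ _
  have hwc : ∀ i, Continuous (w i) := fun i => by fun_prop
  have hW : ∀ y, 0 < ∑ i ∈ t, w i y := by
    intro y
    have hy : y ∈ ⋃ x ∈ t, Φ ⁻¹' (Metric.ball (Φ x) ε) := by rw [ht]; trivial
    simp only [Set.mem_iUnion, Set.mem_preimage, Metric.mem_ball] at hy
    obtain ⟨i, hi, hd⟩ := hy
    refine Finset.sum_pos' (fun i _ => hw0 i y) ⟨i, hi, ?_⟩
    exact lt_max_of_lt_right (by linarith)
  let v : WeakDual.characterSpace ℂ 𝒞 → WeakDual.characterSpace ℂ 𝒞 → ℝ :=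
    fun i y => w i y / ∑ j ∈ t, w j y
  have hvc : ∀ i, Continuous (v i) := fun i =>
    (hwc i).div (continuous_finsetSum _ fun j _ => hwc j) (fun y => (hW y).ne')
  have hv0 : ∀ i y, 0 ≤ v i y := fun i y => div_nonneg (hw0 i y) (hW y).le
  have hv1 : ∀ y, ∑ i ∈ t, v i y = 1 := fun y => by
    simp only [v]; rw [← Finset.sum_div, div_self (hW y).ne']
  have hvd : ∀ i y, v i y ≠ 0 → ∀ g (hg : g ∈ D),
      |(gelf (f g) y).re - (gelf (f g) i).re| < ε := by
    intro i y hvy g hg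
    have hlt : dist (Φ y) (Φ i) < ε := by
      by_contra hcon
      apply hvy
      have : w i y = 0 := max_eq_left (by linarith)
      simp [v, this]
    have := (dist_pi_lt_iff hε).1 hlt ⟨g, hg⟩
    simpa [Real.dist_eq, Φ] using this
  let E : WeakDual.characterSpace ℂ 𝒞 → C(WeakDual.characterSpace ℂ 𝒞, ℂ) :=
    fun i => ⟨fun y => ((v i y : ℝ) : ℂ), Complex.continuous_ofReal.comp (hvc i)⟩
  have hge : ∀ i y, gelf (gelf.symm (E i)) y = ((v i y : ℝ) : ℂ) := by
    intro i y
    rw [StarAlgEquiv.apply_symm_apply]; rfl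
  have hre : ∀ g ∈ D, ∀ y, gelf (f g) y = (((gelf (f g) y).re : ℝ) : ℂ) := by
    intro g hg y
    have h1 := (Complex.nonneg_iff.1 (gelf_nonneg_of_nonneg (hf g hg) y))
    apply Complex.ext <;> simp [← h1.2]
  have hge0 : ∀ g ∈ D, ∀ y, 0 ≤ (gelf (f g) y).re := fun g hg y =>
    (Complex.nonneg_iff.1 (gelf_nonneg_of_nonneg (hf g hg) y)).1
  refine ⟨t, fun i => gelf.symm (E i), fun g i => (gelf (f g) i).re + ε, ?_, ?_, ?_, ?_, ?_⟩
  · intro i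
    apply nonneg_of_gelf_nonneg
    intro y
    rw [hge]
    exact_mod_cast hv0 i y
  · apply EquivLike.injective gelf
    ext y
    rw [map_sum, map_one, ContinuousMap.sum_apply]
    simp only [hge]
    rw [← Complex.ofReal_sum, hv1]
    simp
  · intro g hg i
    have := hge0 g hg i
    linarith
  · intro g hg i
    apply le_of_gelf_le
    intro y
    rw [map_mul, map_smul, ContinuousMap.mul_apply, ContinuousMap.smul_apply, hge, hre g hg y,
      smul_eq_mul, ← Complex.ofReal_mul, ← Complex.ofReal_mul, Complex.real_le_real]
    by_cases h0 : v i y = 0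
    · simp [h0]
    · have := (abs_lt.1 (hvd i y h0 g hg)).2
      rw [mul_comm]
      exact mul_le_mul_of_nonneg_right (by linarith) (hv0 i y)
  · intro g hg
    apply le_of_gelf_le
    intro y
    rw [map_sum, ContinuousMap.sum_apply, map_add, map_smul, map_one, ContinuousMap.add_apply,
      hre g hg y, ContinuousMap.smul_apply, ContinuousMap.one_apply, smul_eq_mul, mul_one]
    simp only [map_smul, ContinuousMap.smul_apply, hge, smul_eq_mul]
    simp only [← Complex.ofReal_mul, ← Complex.ofReal_add, ← Complex.ofReal_sum]
    rw [Complex.real_le_real]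
    calc ∑ i ∈ t, ((gelf (f g) i).re + ε) * v i y
        ≤ ∑ i ∈ t, ((gelf (f g) y).re + 2 * ε) * v i y := by
          refine Finset.sum_le_sum fun i _ => ?_
          by_cases h0 : v i y = 0
          · simp [h0]
          · have := (abs_lt.1 (hvd i y h0 g hg)).1
            exact mul_le_mul_of_nonneg_right (by linarith) (hv0 i y)
      _ = _ := by rw [← Finset.mul_sum, hv1, mul_one]

theorem merge_multiset (n : ℕ) : ∀ S : Multiset 𝒞, S.card = n → (∀ g ∈ S, 0 ≤ g) →
    ∃ D : Finset 𝒞, (∀ g ∈ D, 0 ≤ g) ∧ ∑ g ∈ D, g = S.sum ∧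
      ∀ F : 𝒞 → EReal, (∀ g, F (g + g) = F g + F g) → ∑ g ∈ D, F g = (S.map F).sum := by
  classical
  induction n with
  | zero =>
    intro S hS _
    rw [Multiset.card_eq_zero] at hS
    subst hS
    exact ⟨∅, by simp⟩
  | succ n ih =>
    intro S hS hpos
    by_cases hnd : S.Nodup
    · refine ⟨⟨S, hnd⟩, hpos, ?_, ?_⟩
      · simp [Finset.sum]
      · intro F _; rfl
    · have : ∃ g, ∃ T : Multiset 𝒞, S = g ::ₘ g ::ₘ T := by
        by_contra hcon
        apply hnd
        rw [Multiset.nodup_iff_ne_cons_cons]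
        intro a t h
        exact hcon ⟨a, t, h⟩
      obtain ⟨g, T, rfl⟩ := this
      have hg : 0 ≤ g := hpos g (by simp)
      obtain ⟨D, h1, h2, h3⟩ := ih ((g + g) ::ₘ T) (by simpa using hS) (by
        intro x hx
        rw [Multiset.mem_cons] at hx
        rcases hx with rfl | hx
        · exact add_nonneg hg hg
        · exact hpos x (by simp [hx]))
      refine ⟨D, h1, ?_, ?_⟩
      · rw [h2]; simp [add_assoc]
      · intro F hF
        rw [h3 F hF]; simp [hF, add_assoc]

theorem tSummandC_double (a b : ℂ) :
    tSummandC (a + a) (b + b) = tSummandC a b + tSummandC a b := by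
  unfold tSummandC
  by_cases ha : a = 0
  · simp [ha]
  by_cases hb : b = 0
  · simp [ha, hb]
  · have ha2 : a + a ≠ 0 := by rw [← two_mul]; simp [ha]
    have hb2 : b + b ≠ 0 := by rw [← two_mul]; simp [hb]
    rw [if_neg ha2, if_neg hb2, if_neg ha, if_neg hb, ← EReal.coe_add]
    congr 1
    simp only [Complex.add_re]
    rw [← two_mul, ← two_mul, mul_div_mul_left _ _ (two_ne_zero)]
    ring

/-- The approximations of the summand decrease to it. -/
theorem tendsto_tSummandC {a b : ℂ} (ha : 0 ≤ a) (hb : 0 ≤ b) :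
    Filter.Tendsto (fun ε : ℝ => ((a.re * Real.log ((b.re + 2 * ε) / a.re) : ℝ) : EReal))
      (nhdsWithin 0 (Set.Ioi 0)) (nhds (tSummandC a b)) := by
  unfold tSummandC
  have ha' := Complex.nonneg_iff.1 ha
  have hb' := Complex.nonneg_iff.1 hb
  by_cases h0 : a = 0
  · simp [h0]
  have hare : 0 < a.re := lt_of_le_of_ne ha'.1 fun h => h0 (Complex.ext h.symm ha'.2.symm)
  rw [if_neg h0]
  by_cases hb0 : b = 0
  · rw [if_pos hb0]
    refine EReal.tendsto_coe_nhds_bot_iff.2 ?_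
    refine Filter.Tendsto.const_mul_atBot hare ?_
    refine Real.tendsto_log_nhdsGT_zero.comp ?_
    refine tendsto_nhdsWithin_iff.2 ⟨?_, ?_⟩
    · have : Continuous fun ε : ℝ => (b.re + 2 * ε) / a.re := by fun_prop
      have h := this.tendsto 0
      simp only [hb0, Complex.zero_re, mul_zero, add_zero, zero_div] at h ⊢
      exact h.mono_left nhdsWithin_le_nhds
    · filter_upwards [self_mem_nhdsWithin] with ε hε
      have : (0 : ℝ) < ε := hε
      simp only [hb0, Complex.zero_re, Set.mem_Ioi]
      positivity
  · have hbre : 0 < b.re := lt_of_le_of_ne hb'.1 fun h => hb0 (Complex.ext h.symm hb'.2.symm)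
    rw [if_neg hb0]
    refine (continuous_coe_real_ereal.tendsto _).comp ?_
    have hc : ContinuousAt (fun ε : ℝ => a.re * Real.log ((b.re + 2 * ε) / a.re)) 0 := by
      refine continuousAt_const.mul (ContinuousAt.log (by fun_prop) ?_)
      simp only [mul_zero, add_zero]
      positivity
    have h := hc.tendsto
    simp only [mul_zero, add_zero] at h
    exact h.mono_left nhdsWithin_le_nhds

theorem tSummandC_ne_top (a b : ℂ) : tSummandC a b ≠ ⊤ := by
  unfold tSummandC
  split_ifs
  · simp
  · simp
  · exact EReal.coe_ne_top _

theorem tendsto_sum_ereal {ι : Type*} (D : Finset ι) (F : ι → ℝ → EReal) (l : ι → EReal)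
    (L : Filter ℝ) (hF : ∀ g ∈ D, Filter.Tendsto (F g) L (nhds (l g))) (hl : ∀ g ∈ D, l g ≠ ⊤) :
    Filter.Tendsto (fun ε => ∑ g ∈ D, F g ε) L (nhds (∑ g ∈ D, l g)) ∧ ∑ g ∈ D, l g ≠ ⊤ := by
  classical
  induction D using Finset.induction_on with
  | empty => simpa using tendsto_const_nhds
  | insert a s ha ih =>
    obtain ⟨h1, h2⟩ := ih (fun g hg => hF g (by simp [hg])) (fun g hg => hl g (by simp [hg]))
    have h3 := hF a (by simp)
    have h4 := hl a (by simp)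
    simp only [Finset.sum_insert ha]
    refine ⟨?_, EReal.add_ne_top h4 h2⟩
    exact (EReal.continuousAt_add (p := (l a, ∑ g ∈ s, l g)) (Or.inl h4) (Or.inr h2)).tendsto.comp
      (h3.prodMk_nhds h1)

/-- Pointwise estimate of one summand. -/
theorem tSummandC_le {a b : ℂ} (ha : 0 ≤ a) (hb : 0 ≤ b) {me ue C ug K : ℝ}
    (hme : 0 ≤ me) (hC : 0 ≤ C) (haue : a.re ≤ ue) (haug : a.re ≤ ug) (hK : 0 < K)
    (hbm : b.re ≤ C * me) :
    tSummandC a b ≤ ((a.re * (me / ue) - a.re + ug / K * (C * ue) - a.re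
      + a.re * Real.log (K / ug) : ℝ) : EReal) := by
  unfold tSummandC
  have ha' := Complex.nonneg_iff.1 ha
  have hb' := Complex.nonneg_iff.1 hb
  by_cases h0 : a = 0
  · subst h0
    rw [if_pos rfl]
    simp only [Complex.zero_re] at *
    norm_cast
    have : 0 ≤ ug / K * (C * ue) := by positivity
    simpa using this
  have hare : 0 < a.re := lt_of_le_of_ne ha'.1 fun h => h0 (Complex.ext h.symm ha'.2.symm)
  rw [if_neg h0]
  by_cases hb0 : b = 0
  · rw [if_pos hb0]; exact bot_le
  have hbre : 0 < b.re := lt_of_le_of_ne hb'.1 fun h => hb0 (Complex.ext h.symm hb'.2.symm)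
  rw [if_neg hb0]
  rw [EReal.coe_le_coe_iff]
  generalize a.re = x at *
  generalize b.re = y at *
  have hue : 0 < ue := by linarith
  have hug : 0 < ug := by linarith
  have hCme : 0 < C * me := by linarith
  have hme' : 0 < me := lt_of_le_of_ne hme fun h => by simp [← h] at hCme
  have hC' : 0 < C := lt_of_le_of_ne hC fun h => by simp [← h] at hCme
  have h1 : Real.log (y / x) ≤ Real.log (C * me / x) :=
    Real.log_le_log (by positivity) (by gcongr)
  have h2 : C * me / x = (me / ue) * ((ug / K * (C * ue)) / x) * (K / ug) := by
    field_simp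
  have h3 : Real.log (C * me / x) =
      Real.log (me / ue) + Real.log ((ug / K * (C * ue)) / x) + Real.log (K / ug) := by
    rw [h2, Real.log_mul (by positivity) (by positivity),
      Real.log_mul (by positivity) (by positivity)]
  have h4 := Real.log_le_sub_one_of_pos (x := me / ue) (by positivity)
  have h5 := Real.log_le_sub_one_of_pos (x := (ug / K * (C * ue)) / x) (by positivity)
  calc x * Real.log (y / x)
      ≤ x * ((me / ue - 1) + ((ug / K * (C * ue)) / x - 1) + Real.log (K / ug)) := by
        gcongr; linarith
    _ = _ := by field_simp; ring

theorem IsState.re_mono {m : 𝒞 →ₗ[ℂ] ℂ} (hm : IsState m) {f g : 𝒞} (h : f ≤ g) :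
    (m f).re ≤ (m g).re := by
  have := (Complex.nonneg_iff.1 (hm.1 (g - f) (sub_nonneg.2 h))).1
  rw [map_sub, Complex.sub_re] at this
  linarith

theorem coe_sum_ereal {ι : Type*} (s : Finset ι) (f : ι → ℝ) :
    ((∑ i ∈ s, f i : ℝ) : EReal) = ∑ i ∈ s, (f i : EReal) := by
  classical
  induction s using Finset.induction_on with
  | empty => simp
  | insert a s ha ih => rw [Finset.sum_insert ha, Finset.sum_insert ha, EReal.coe_add, ih]

theorem main_bound (d : 𝒞 →⋆ₐ[ℂ] 𝒞) (A B : 𝒞 →ₗ[ℂ] 𝒞) (n : ℕ) (hB : B = A ^ n)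
    (hB_pos : ∀ f : 𝒞, 0 ≤ f → 0 ≤ B f)
    (hB_hom : ∀ f g : 𝒞, B (d f * g) = f * B g)
    (μ : 𝒞 →ₗ[ℂ] ℂ) (hμ : IsState μ) (hμinv : ∀ f : 𝒞, μ (d f) = μ f)
    (D : Finset 𝒞) (hD : IsPartitionOfUnityAlg D) (ε : ℝ) (hε : 0 < ε) :
    tauNAlg A μ n ≤
      ∑ g ∈ D, (((μ g).re * Real.log (((μ (B g)).re + 2 * ε) / (μ g).re) : ℝ) : EReal) := by
  classical
  obtain ⟨t, e, C, he0, he1, hC0, hCe, hCs⟩ :=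
    exists_fine D B (fun g hg => hB_pos g (hD.1 g hg)) ε hε
  have hd0 : ∀ f : 𝒞, 0 ≤ f → 0 ≤ d f := fun f hf => map_nonneg d hf
  have hh0 : ∀ g ∈ D, ∀ i, 0 ≤ d (e i) * g := fun g hg i =>
    alg_mul_nonneg (hd0 _ (he0 i)) (hD.1 g hg)
  have hsum1 : ∀ g, ∑ i ∈ t, d (e i) * g = g := by
    intro g
    rw [← Finset.sum_mul, ← map_sum, he1, map_one, one_mul]
  have hsum2 : ∀ i, ∑ g ∈ D, d (e i) * g = d (e i) := by
    intro i
    rw [← Finset.mul_sum, hD.2, mul_one]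
  let S : Multiset 𝒞 := (D ×ˢ t).val.map (fun p => d (e p.2) * p.1)
  obtain ⟨D', h1, h2, h3⟩ := merge_multiset (S.card) S rfl (by
    intro x hx
    obtain ⟨p, hp, rfl⟩ := Multiset.mem_map.1 hx
    exact hh0 p.1 (Finset.mem_product.1 hp).1 p.2)
  have hD' : IsPartitionOfUnityAlg D' := by
    refine ⟨h1, ?_⟩
    rw [h2]
    change ∑ p ∈ D ×ˢ t, d (e p.2) * p.1 = 1
    rw [Finset.sum_product]
    simp only [hsum1, hD.2]
  refine (iInf₂_le D' hD').trans (iSup₂_le fun m hm => ?_)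
  rw [← hB, h3 (fun g => tSummandC (μ g) (m (B g))) (by
    intro g; simp only [map_add]; exact tSummandC_double _ _), Multiset.map_map]
  change ∑ p ∈ D ×ˢ t, tSummandC (μ (d (e p.2) * p.1)) (m (B (d (e p.2) * p.1))) ≤ _
  rw [Finset.sum_product]
  have hμe : ∀ i, 0 ≤ (μ (e i)).re := fun i => (Complex.nonneg_iff.1 (hμ.1 _ (he0 i))).1
  have hme : ∀ i, 0 ≤ (m (e i)).re := fun i => (Complex.nonneg_iff.1 (hm.1 _ (he0 i))).1
  have hμg : ∀ g ∈ D, 0 ≤ (μ g).re := fun g hg => (Complex.nonneg_iff.1 (hμ.1 _ (hD.1 g hg))).1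
  have ha0 : ∀ g ∈ D, ∀ i, 0 ≤ (μ (d (e i) * g)).re := fun g hg i =>
    (Complex.nonneg_iff.1 (hμ.1 _ (hh0 g hg i))).1
  have hK : ∀ g ∈ D, 0 < (μ (B g)).re + 2 * ε := fun g hg => by
    have := (Complex.nonneg_iff.1 (hμ.1 _ (hB_pos g (hD.1 g hg)))).1
    linarith
  have hs1 : ∀ g, ∑ i ∈ t, (μ (d (e i) * g)).re = (μ g).re := fun g => by
    rw [← Complex.re_sum, ← map_sum, hsum1]
  have hs2 : ∀ i, ∑ g ∈ D, (μ (d (e i) * g)).re = (μ (e i)).re := fun i => by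
    rw [← Complex.re_sum, ← map_sum, hsum2, hμinv]
  have hpt : ∀ g ∈ D, ∀ i ∈ t, tSummandC (μ (d (e i) * g)) (m (B (d (e i) * g))) ≤
      (((μ (d (e i) * g)).re * ((m (e i)).re / (μ (e i)).re) - (μ (d (e i) * g)).re
        + (μ g).re / ((μ (B g)).re + 2 * ε) * (C g i * (μ (e i)).re) - (μ (d (e i) * g)).re
        + (μ (d (e i) * g)).re * Real.log (((μ (B g)).re + 2 * ε) / (μ g).re) : ℝ) : EReal) := by
    intro g hg i hi
    refine tSummandC_le (hμ.1 _ (hh0 g hg i)) (hm.1 _ (hB_pos _ (hh0 g hg i))) (hme i)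
      (hC0 g hg i) ?_ ?_ (hK g hg) ?_
    · rw [← hs2 i]
      exact Finset.single_le_sum (f := fun g => (μ (d (e i) * g)).re)
        (fun g hg => ha0 g hg i) hg
    · rw [← hs1 g]
      exact Finset.single_le_sum (f := fun i => (μ (d (e i) * g)).re)
        (fun i _ => ha0 g hg i) hi
    · rw [hB_hom]
      have := hm.re_mono (hCe g hg i)
      simpa using this
  refine (Finset.sum_le_sum fun g hg => Finset.sum_le_sum (hpt g hg)).trans ?_
  simp only [← coe_sum_ereal]
  rw [EReal.coe_le_coe_iff]
  simp only [Finset.sum_add_distrib, Finset.sum_sub_distrib, ← Finset.sum_mul, ← Finset.mul_sum,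
    hs1]
  have hT : ∑ g ∈ D, (μ g).re = 1 := by
    rw [← Complex.re_sum, ← map_sum, hD.2, hμ.2]; rfl
  have hM : ∑ g ∈ D, ∑ i ∈ t, (μ (d (e i) * g)).re * ((m (e i)).re / (μ (e i)).re) ≤ 1 := by
    rw [Finset.sum_comm]
    simp only [← Finset.sum_mul, hs2]
    calc ∑ i ∈ t, (μ (e i)).re * ((m (e i)).re / (μ (e i)).re) ≤ ∑ i ∈ t, (m (e i)).re := by
          refine Finset.sum_le_sum fun i _ => ?_
          by_cases h0 : (μ (e i)).re = 0
          · simpa [h0] using hme i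
          · rw [mul_div_cancel₀ _ h0]
      _ = 1 := by rw [← Complex.re_sum, ← map_sum, he1, hm.2]; rfl
  have hN : ∑ g ∈ D, (μ g).re / ((μ (B g)).re + 2 * ε) * ∑ i ∈ t, C g i * (μ (e i)).re ≤ 1 := by
    rw [← hT]
    refine Finset.sum_le_sum fun g hg => ?_
    have hle : ∑ i ∈ t, C g i * (μ (e i)).re ≤ (μ (B g)).re + 2 * ε := by
      have := hμ.re_mono (hCs g hg)
      simpa [hμ.2] using this
    rw [div_mul_eq_mul_div, div_le_iff₀ (hK g hg)]
    exact mul_le_mul_of_nonneg_left hle (hμg g hg)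
  linarith

theorem exists_pow_hom (δ : 𝒞 →⋆ₐ[ℂ] 𝒞) (A : 𝒞 →ₗ[ℂ] 𝒞)
    (hA_pos : ∀ f : 𝒞, 0 ≤ f → 0 ≤ A f)
    (hA_hom : ∀ f g : 𝒞, A ((δ f) * g) = f * A g)
    (μ : 𝒞 →ₗ[ℂ] ℂ) (hμinv : ∀ f : 𝒞, μ (δ f) = μ f) (n : ℕ) :
    ∃ d : 𝒞 →⋆ₐ[ℂ] 𝒞, (∀ f g : 𝒞, (A ^ n) (d f * g) = f * (A ^ n) g) ∧
      (∀ f : 𝒞, 0 ≤ f → 0 ≤ (A ^ n) f) ∧ ∀ f, μ (d f) = μ f := by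
  induction n with
  | zero => exact ⟨StarAlgHom.id ℂ 𝒞, by simp, by simp, by simp⟩
  | succ n ih =>
    obtain ⟨d, h1, h2, h3⟩ := ih
    refine ⟨δ.comp d, fun f g => ?_, fun f hf => ?_, fun f => ?_⟩
    · rw [pow_succ, Module.End.mul_apply, Module.End.mul_apply, StarAlgHom.comp_apply, hA_hom, h1]
    · rw [pow_succ, Module.End.mul_apply]
      exact h2 _ (hA_pos _ hf)
    · rw [StarAlgHom.comp_apply, hμinv, h3]

/-- **Theorem 2.7.** For a transfer operator `A` of a `C*`-dynamical system `(𝒞, δ)` and a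
`δ`-invariant state `μ`, the `t`-entropy satisfies
`τ(μ) = inf_{n, D} (1/n) Σ_{g ∈ D} μ(g) ln(μ(Aⁿg)/μ(g))`. -/
theorem tEntropyAlg_eq_inf_eval_at_mu
    (δ : 𝒞 →⋆ₐ[ℂ] 𝒞) (A : 𝒞 →ₗ[ℂ] 𝒞)
    (hA_pos : ∀ f : 𝒞, 0 ≤ f → 0 ≤ A f)
    (hA_hom : ∀ f g : 𝒞, A ((δ f) * g) = f * A g)
    (μ : 𝒞 →ₗ[ℂ] ℂ) (hμ : IsState μ)
    (hμinv : ∀ f : 𝒞, μ (δ f) = μ f) :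
    tEntropyAlg A μ =
      ⨅ (n : ℕ+) (D : Finset 𝒞) (_ : IsPartitionOfUnityAlg D),
        ((((n : ℕ) : ℝ))⁻¹ : EReal) * ∑ g ∈ D, tSummandC (μ g) (μ ((A ^ (n : ℕ)) g)) := by
  apply le_antisymm
  · refine le_iInf fun n => le_iInf₂ fun D hD => ?_
    refine (iInf_le _ n).trans ?_
    refine mul_le_mul_of_nonneg_left ?_ ?_
    · obtain ⟨d, h1, h2, h3⟩ := exists_pow_hom δ A hA_pos hA_hom μ hμinv n
      have hlim := (tendsto_sum_ereal D
        (fun g ε => (((μ g).re * Real.log (((μ ((A ^ (n : ℕ)) g)).re + 2 * ε) / (μ g).re) : ℝ) :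
          EReal))
        (fun g => tSummandC (μ g) (μ ((A ^ (n : ℕ)) g))) (nhdsWithin 0 (Set.Ioi 0))
        (fun g hg => tendsto_tSummandC (hμ.1 g (hD.1 g hg)) (hμ.1 _ (h2 g (hD.1 g hg))))
        (fun g _ => tSummandC_ne_top _ _)).1
      refine ge_of_tendsto hlim ?_
      filter_upwards [self_mem_nhdsWithin] with ε hε
      exact main_bound d A (A ^ (n : ℕ)) n rfl h2 h1 μ hμ h3 D hD ε hε
    · exact EReal.inv_nonneg_of_nonneg (by exact_mod_cast (Nat.zero_le (n : ℕ)))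
  · refine le_iInf fun n => ?_
    have hn : (0 : EReal) < (((n : ℕ) : ℝ) : EReal) := by
      exact_mod_cast n.pos
    rw [← EReal.div_eq_inv_mul, EReal.le_div_iff_mul_le hn (EReal.coe_ne_top _)]
    refine le_iInf₂ fun D hD => ?_
    refine le_trans ?_ (le_iSup₂ μ hμ)
    rw [← EReal.le_div_iff_mul_le hn (EReal.coe_ne_top _), EReal.div_eq_inv_mul]
    exact (iInf_le _ n).trans (iInf₂_le D hD)

end
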